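/- Fix n ∈ ℕ, n ≥ 1, ξ ∈ [0,1), and let k* ∈ {1,…,2^n} be the index with ξ ∈ I_n(k*). Let f : [0,1) → ℝ be a step function f = Σ_{k=1}^{2^n} a_k χ_{I_n(k)} with real numbers a_1,…,a_{2^n}. Then for every i ∈ {1,…,2^n} and every x ∈ I_n(i): if k* < i, then S_{2^n}(∫_ξ^{·} f(t)dt)(x) = a_{k*}(k*/2^n − ξ) + Σ_{k=k*+1}^{i−1} a_k/2^n + a_i/2^{n+1}; if k* = i, then S_{2^n}(∫_ξ^{·} f(t)dt)(x) = a_{k*}((2k*−1)/2^{n+1} − ξ); if k* > i, then S_{2^n}(∫_ξ^{·} f(t)dt)(x) = −Σ_{k=i+1}^{k*−1} a_k/2^n − a_i/2^{n+1} + a_{k*}((k*−1)/2^n − ξ). -/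

import Mathlib

open MeasureTheory Matrix

/-- The `k`-th binary digit of `x ∈ [0,1)`, using the expansion terminating in zeros
for dyadic rationals. -/
noncomputable def binDigit (k : ℕ) (x : ℝ) : ℕ := ⌊x * 2 ^ (k + 1)⌋.toNat % 2

/-- Rademacher functions `r_k(x) = (-1)^{x_k}`. -/
noncomputable def rademacher (k : ℕ) (x : ℝ) : ℝ := (-1 : ℝ) ^ binDigit k x

/-- Walsh–Paley functions `ω_n(x) = ∏_k r_k(x)^{n_k}`. -/
noncomputable def walsh (n : ℕ) (x : ℝ) : ℝ :=
  ∏ k ∈ Finset.range n, if n.testBit k then rademacher k x else 1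

/-- Walsh–Fourier coefficient `f̂_k = ∫₀¹ f ω_k`. -/
noncomputable def fcoef (f : ℝ → ℝ) (k : ℕ) : ℝ := ∫ x in (0:ℝ)..1, f x * walsh k x

/-- The `2^n`-th partial sum of the Walsh–Fourier series:
`S_{2^n} f (x) = ∑_{k<2^n} f̂_k ω_k(x)`. -/
noncomputable def S2 (n : ℕ) (f : ℝ → ℝ) (x : ℝ) : ℝ :=
  ∑ k ∈ Finset.range (2 ^ n), fcoef f k * walsh k x

theorem walsh_eq_prod_range {n k : ℕ} (hk : k < 2 ^ n) (x : ℝ) :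
    walsh k x = ∏ j ∈ Finset.range n, if k.testBit j then rademacher j x else 1 := by
  have key : ∀ {m j : ℕ}, k < 2 ^ m → j ∉ Finset.range m →
      (if k.testBit j then rademacher j x else 1) = 1 := by
    intro m j hm hj
    have hmj : m ≤ j := by simpa using hj
    rw [Nat.testBit_lt_two_pow (hm.trans_le (Nat.pow_le_pow_right two_pos hmj))]
    simp
  rw [walsh]
  rcases le_total n k with h | h
  · exact (Finset.prod_subset (Finset.range_mono h) fun j _ hj => key hk hj).symm
  · exact Finset.prod_subset (Finset.range_mono h) fun j _ hj => key Nat.lt_two_pow_self hj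

theorem walsh_two_pow_add {n k : ℕ} (hk : k < 2 ^ n) (x : ℝ) :
    walsh (2 ^ n + k) x = walsh k x * rademacher n x := by
  have h : 2 ^ n + k < 2 ^ (n + 1) := by rw [pow_succ]; omega
  rw [walsh_eq_prod_range h, Finset.prod_range_succ, walsh_eq_prod_range hk]
  congr 1
  · refine Finset.prod_congr rfl fun j hj => ?_
    rw [Nat.testBit_two_pow_add_gt (Finset.mem_range.1 hj)]
  · rw [Nat.testBit_two_pow_add_eq, Nat.testBit_lt_two_pow hk]
    simp

theorem sum_walsh_mul_walsh (n : ℕ) (t x : ℝ) :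
    ∑ k ∈ Finset.range (2 ^ n), walsh k t * walsh k x =
      ∏ j ∈ Finset.range n, (1 + rademacher j t * rademacher j x) := by
  induction n with
  | zero => simp [walsh]
  | succ n ih =>
    rw [pow_succ, mul_two, Finset.sum_range_add, Finset.prod_range_succ, ← ih, mul_add, mul_one,
      Finset.sum_mul]
    congr 1
    refine Finset.sum_congr rfl fun k hk => ?_
    rw [walsh_two_pow_add (Finset.mem_range.1 hk), walsh_two_pow_add (Finset.mem_range.1 hk)]
    ring

theorem one_add_rademacher_mul (j : ℕ) (t x : ℝ) :
    1 + rademacher j t * rademacher j x = if binDigit j t = binDigit j x then 2 else 0 := by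
  have ht : binDigit j t = 0 ∨ binDigit j t = 1 := Nat.mod_two_eq_zero_or_one _
  have hx : binDigit j x = 0 ∨ binDigit j x = 1 := Nat.mod_two_eq_zero_or_one _
  rcases ht with ht | ht <;> rcases hx with hx | hx <;> simp [rademacher, ht, hx] <;> norm_num

theorem natFloor_mul_two_pow_succ_div_two (n : ℕ) (x : ℝ) :
    ⌊x * 2 ^ (n + 1)⌋₊ / 2 = ⌊x * 2 ^ n⌋₊ := by
  rw [← Nat.floor_div_ofNat]
  congr 1
  rw [pow_succ, ← mul_assoc]
  exact mul_div_cancel_right₀ _ two_ne_zero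

theorem sum_walsh_mul_walsh_eq_ite (n : ℕ) {t x : ℝ} (ht : t < 1) (hx : x < 1) :
    ∑ k ∈ Finset.range (2 ^ n), walsh k t * walsh k x =
      if ⌊t * 2 ^ n⌋₊ = ⌊x * 2 ^ n⌋₊ then 2 ^ n else 0 := by
  rw [sum_walsh_mul_walsh]
  induction n with
  | zero => simp [Nat.floor_eq_zero.2 ht, Nat.floor_eq_zero.2 hx]
  | succ n ih =>
    have h : ⌊t * 2 ^ (n + 1)⌋₊ = ⌊x * 2 ^ (n + 1)⌋₊ ↔
        ⌊t * 2 ^ n⌋₊ = ⌊x * 2 ^ n⌋₊ ∧ binDigit n t = binDigit n x := by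
      rw [← natFloor_mul_two_pow_succ_div_two n t, ← natFloor_mul_two_pow_succ_div_two n x,
        binDigit, binDigit, Int.floor_toNat, Int.floor_toNat]
      omega
    rw [Finset.prod_range_succ, ih, one_add_rademacher_mul]
    simp only [h, ite_and]
    split_ifs <;> simp [pow_succ]

theorem measurable_rademacher (k : ℕ) : Measurable (rademacher k) := by
  have h : Measurable fun x : ℝ => ⌊x * 2 ^ (k + 1)⌋ :=
    Int.measurable_floor.comp (measurable_id.mul_const _)
  exact (measurable_from_top (f := fun z : ℤ => (-1 : ℝ) ^ (z.toNat % 2))).comp h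

theorem measurable_walsh (n : ℕ) : Measurable (walsh n) := by
  unfold walsh
  refine Finset.measurable_fun_prod _ fun k _ => ?_
  split_ifs
  · exact measurable_rademacher k
  · exact measurable_const

theorem norm_walsh (n : ℕ) (x : ℝ) : ‖walsh n x‖ = 1 := by
  rw [walsh, norm_prod]
  refine Finset.prod_eq_one fun k _ => ?_
  split_ifs <;> simp [rademacher]

theorem intervalIntegrable_mul_walsh {F : ℝ → ℝ} {u v : ℝ}
    (hF : IntervalIntegrable F volume u v) (k : ℕ) :
    IntervalIntegrable (fun t => F t * walsh k t) volume u v := by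
  have h : ∀ {μ : Measure ℝ}, Integrable F μ → Integrable (fun t => F t * walsh k t) μ :=
    fun hμ => hμ.mul_bdd (c := 1) (measurable_walsh k).aestronglyMeasurable
      (Filter.Eventually.of_forall fun t => (norm_walsh k t).le)
  exact ⟨h hF.1, h hF.2⟩

/-- **Paley's lemma**: `S_{2^n} F` averages `F` over dyadic intervals of length `2^{-n}`. -/
theorem S2_eq_average {n i : ℕ} (hi1 : 1 ≤ i) (hi2 : i ≤ 2 ^ n) {F : ℝ → ℝ}
    (hF : IntervalIntegrable F volume 0 1) {x : ℝ}
    (hx1 : ((i : ℝ) - 1) / 2 ^ n ≤ x) (hx2 : x < (i : ℝ) / 2 ^ n) :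
    S2 n F x = 2 ^ n * ∫ t in (((i : ℝ) - 1) / 2 ^ n)..((i : ℝ) / 2 ^ n), F t := by
  have hp : (0 : ℝ) < 2 ^ n := by positivity
  have hi1' : (1 : ℝ) ≤ i := by exact_mod_cast hi1
  have hi2' : (i : ℝ) ≤ 2 ^ n := by exact_mod_cast hi2
  have hc0 : 0 ≤ ((i : ℝ) - 1) / 2 ^ n := div_nonneg (by linarith) hp.le
  have hd1 : (i : ℝ) / 2 ^ n ≤ 1 := (div_le_one hp).2 hi2'
  have hfloor : ∀ t : ℝ, 0 ≤ t →
      (⌊t * 2 ^ n⌋₊ = i - 1 ↔ t ∈ Set.Ico (((i : ℝ) - 1) / 2 ^ n) ((i : ℝ) / 2 ^ n)) := by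
    intro t ht
    rw [Nat.floor_eq_iff (by positivity), Set.mem_Ico, div_le_iff₀ hp, lt_div_iff₀ hp,
      Nat.cast_sub hi1]
    simp
  have hxf : ⌊x * 2 ^ n⌋₊ = i - 1 := (hfloor x (hc0.trans hx1)).2 ⟨hx1, hx2⟩
  have hsum : S2 n F x = ∫ t in (0 : ℝ)..1,
      ∑ k ∈ Finset.range (2 ^ n), F t * walsh k t * walsh k x := by
    rw [intervalIntegral.integral_finsetSum fun k _ =>
      (intervalIntegrable_mul_walsh hF k).mul_const _]
    simp only [S2, fcoef, intervalIntegral.integral_mul_const]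
  have hle : ((i : ℝ) - 1) / 2 ^ n ≤ (i : ℝ) / 2 ^ n := hx1.trans hx2.le
  rw [hsum, intervalIntegral.integral_of_le zero_le_one, intervalIntegral.integral_of_le hle,
    ← integral_Ico_eq_integral_Ioc, ← integral_Ico_eq_integral_Ioc, ← integral_const_mul]
  have hsub : Set.Ico (((i : ℝ) - 1) / 2 ^ n) ((i : ℝ) / 2 ^ n) ⊆ Set.Ico 0 1 :=
    Set.Ico_subset_Ico hc0 hd1
  rw [← Set.inter_eq_self_of_subset_right hsub, ← setIntegral_indicator measurableSet_Ico]
  refine setIntegral_congr_fun measurableSet_Ico fun t ht => ?_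
  simp only [mul_assoc, ← Finset.mul_sum]
  rw [sum_walsh_mul_walsh_eq_ite n ht.2 (hx2.trans_le hd1), hxf, Set.indicator_apply]
  simp only [hfloor t ht.1]
  split_ifs <;> ring

theorem integral_eq_of_eq_on_Ico {f : ℝ → ℝ} {c d A s : ℝ}
    (h : ∀ t, c ≤ t → t < d → f t = A) (hcs : c ≤ s) (hsd : s ≤ d) :
    ∫ t in c..s, f t = A * (s - c) := by
  rw [intervalIntegral.integral_of_le hcs, ← integral_Ico_eq_integral_Ioc,
    setIntegral_congr_fun (g := fun _ => A) measurableSet_Ico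
      fun t ht => h t ht.1 (ht.2.trans_le hsd),
    integral_Ico_eq_integral_Ioc, ← intervalIntegral.integral_of_le hcs,
    intervalIntegral.integral_const, smul_eq_mul, mul_comm]

theorem integrable_step (n : ℕ) (a : ℕ → ℝ) :
    Integrable fun t : ℝ => ∑ k ∈ Finset.Icc 1 (2 ^ n), a k *
      (if ((k : ℝ) - 1) / 2 ^ n ≤ t ∧ t < (k : ℝ) / 2 ^ n then (1 : ℝ) else 0) := by
  refine integrable_finsetSum _ fun k _ => Integrable.const_mul ?_ _
  have h : Integrable ((Set.Ico (((k : ℝ) - 1) / 2 ^ n) ((k : ℝ) / 2 ^ n)).indicator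
      fun _ => (1 : ℝ)) := by
    rw [integrable_indicator_iff measurableSet_Ico]
    exact integrableOn_const (by simp)
  exact h.congr (Filter.Eventually.of_forall fun t => by simp [Set.indicator_apply])

theorem step_apply {n k : ℕ} (hk1 : 1 ≤ k) (hk2 : k ≤ 2 ^ n) (a : ℕ → ℝ) {t : ℝ}
    (ht1 : ((k : ℝ) - 1) / 2 ^ n ≤ t) (ht2 : t < (k : ℝ) / 2 ^ n) :
    ∑ j ∈ Finset.Icc 1 (2 ^ n), a j *
      (if ((j : ℝ) - 1) / 2 ^ n ≤ t ∧ t < (j : ℝ) / 2 ^ n then (1 : ℝ) else 0) = a k := by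
  have hp : (0 : ℝ) < 2 ^ n := by positivity
  rw [Finset.sum_eq_single_of_mem k (Finset.mem_Icc.2 ⟨hk1, hk2⟩), if_pos ⟨ht1, ht2⟩, mul_one]
  intro j _ hjk
  rw [if_neg, mul_zero]
  rintro ⟨h1, h2⟩
  have h3 := (div_lt_div_iff_of_pos_right hp).1 (h1.trans_lt ht2)
  have h4 := (div_lt_div_iff_of_pos_right hp).1 (ht1.trans_lt h2)
  have h5 : j < k + 1 := by exact_mod_cast (by linarith : (j : ℝ) < k + 1)
  have h6 : k < j + 1 := by exact_mod_cast (by linarith : (k : ℝ) < j + 1)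
  omega

theorem integral_step_eq_sum {n : ℕ} {a : ℕ → ℝ} {f : ℝ → ℝ} (hf : Integrable f)
    (hfa : ∀ k : ℕ, 1 ≤ k → k ≤ 2 ^ n → ∀ t : ℝ,
      ((k : ℝ) - 1) / 2 ^ n ≤ t → t < (k : ℝ) / 2 ^ n → f t = a k)
    {m : ℕ} (hm : m ≤ 2 ^ n) :
    ∫ t in (0 : ℝ)..((m : ℝ) / 2 ^ n), f t = ∑ k ∈ Finset.Ico 1 (m + 1), a k / 2 ^ n := by
  induction m with
  | zero => simp
  | succ m ih =>
    have h := hfa (m + 1) (by omega) hm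
    rw [Nat.cast_add_one, add_sub_cancel_right] at h
    rw [← intervalIntegral.integral_add_adjacent_intervals (b := (m : ℝ) / 2 ^ n)
      hf.intervalIntegrable hf.intervalIntegrable, ih (by omega),
      Finset.sum_Ico_succ_top (b := m + 1) (by omega), Nat.cast_add_one,
      integral_eq_of_eq_on_Ico h (by gcongr; linarith) le_rfl]
    ring

theorem integral_step {n : ℕ} {a : ℕ → ℝ} {f : ℝ → ℝ} (hf : Integrable f)
    (hfa : ∀ k : ℕ, 1 ≤ k → k ≤ 2 ^ n → ∀ t : ℝ,
      ((k : ℝ) - 1) / 2 ^ n ≤ t → t < (k : ℝ) / 2 ^ n → f t = a k)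
    {k : ℕ} (hk1 : 1 ≤ k) (hk2 : k ≤ 2 ^ n) {s : ℝ}
    (hs1 : ((k : ℝ) - 1) / 2 ^ n ≤ s) (hs2 : s ≤ (k : ℝ) / 2 ^ n) :
    ∫ t in (0 : ℝ)..s, f t =
      ∑ j ∈ Finset.Ico 1 k, a j / 2 ^ n + a k * (s - ((k : ℝ) - 1) / 2 ^ n) := by
  rw [← intervalIntegral.integral_add_adjacent_intervals (b := ((k : ℝ) - 1) / 2 ^ n)
    hf.intervalIntegrable hf.intervalIntegrable,
    integral_eq_of_eq_on_Ico (hfa k hk1 hk2) hs1 hs2]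
  have h := integral_step_eq_sum hf hfa (m := k - 1) (by omega)
  rw [Nat.cast_sub hk1, Nat.cast_one, Nat.sub_add_cancel hk1] at h
  rw [h]

theorem sum_Ico_one_eq_add {g : ℕ → ℝ} {k i : ℕ} (hk : 1 ≤ k) (hki : k < i) :
    ∑ j ∈ Finset.Ico 1 i, g j = ∑ j ∈ Finset.Ico 1 k, g j + (g k + ∑ j ∈ Finset.Ioo k i, g j) := by
  rw [← Finset.sum_Ico_consecutive g hk hki.le, ← Finset.Ioo_insert_left hki,
    Finset.sum_insert Finset.left_notMem_Ioo]

/-- `S_{2^n}(∫_ξ^· f)` for a step function `f = ∑ a_k χ_{I_n(k)}`, evaluated on each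
dyadic interval `I_n(i)`, where `ξ ∈ I_n(k*)`. -/
theorem S2_integral_step_function (n : ℕ) (hn : 1 ≤ n) (ξ : ℝ)
    (hξ : ξ ∈ Set.Ico (0:ℝ) 1)
    (kstar : ℕ) (hk1 : 1 ≤ kstar) (hk2 : kstar ≤ 2 ^ n)
    (hξ1 : ((kstar : ℝ) - 1) / 2 ^ n ≤ ξ) (hξ2 : ξ < (kstar : ℝ) / 2 ^ n)
    (a : ℕ → ℝ) (f : ℝ → ℝ)
    (hf : ∀ t : ℝ, f t = ∑ k ∈ Finset.Icc 1 (2 ^ n), a k *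
      (if ((k : ℝ) - 1) / 2 ^ n ≤ t ∧ t < (k : ℝ) / 2 ^ n then 1 else 0)) :
    ∀ i : ℕ, 1 ≤ i → i ≤ 2 ^ n →
      ∀ x : ℝ, ((i : ℝ) - 1) / 2 ^ n ≤ x → x < (i : ℝ) / 2 ^ n →
        (kstar < i → S2 n (fun s => ∫ t in ξ..s, f t) x =
          a kstar * ((kstar : ℝ) / 2 ^ n - ξ) +
            (∑ k ∈ Finset.Ioo kstar i, a k / 2 ^ n) + a i / 2 ^ (n + 1)) ∧
        (kstar = i → S2 n (fun s => ∫ t in ξ..s, f t) x =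
          a kstar * ((2 * (kstar : ℝ) - 1) / 2 ^ (n + 1) - ξ)) ∧
        (i < kstar → S2 n (fun s => ∫ t in ξ..s, f t) x =
          -(∑ k ∈ Finset.Ioo i kstar, a k / 2 ^ n) - a i / 2 ^ (n + 1) +
            a kstar * (((kstar : ℝ) - 1) / 2 ^ n - ξ)) := by
  have hfi : Integrable f := by
    rw [funext hf]
    exact integrable_step n a
  have hfa : ∀ k : ℕ, 1 ≤ k → k ≤ 2 ^ n → ∀ t : ℝ,
      ((k : ℝ) - 1) / 2 ^ n ≤ t → t < (k : ℝ) / 2 ^ n → f t = a k :=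
    fun k h1 h2 t h3 h4 => (hf t).trans (step_apply h1 h2 a h3 h4)
  intro i hi1 hi2 x hx1 hx2
  have hp : (0 : ℝ) < 2 ^ n := by positivity
  have hF : ∀ s, ∫ t in ξ..s, f t = (∫ t in (0 : ℝ)..s, f t) - ∫ t in (0 : ℝ)..ξ, f t :=
    fun s => (intervalIntegral.integral_interval_sub_left hfi.intervalIntegrable
      hfi.intervalIntegrable).symm
  have hcont : Continuous fun s => ∫ t in ξ..s, f t :=
    intervalIntegral.continuous_primitive (fun _ _ => hfi.intervalIntegrable) ξ
  have hS : S2 n (fun s => ∫ t in ξ..s, f t) x =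
      ∑ j ∈ Finset.Ico 1 i, a j / 2 ^ n + a i / 2 ^ (n + 1) -
        (∑ j ∈ Finset.Ico 1 kstar, a j / 2 ^ n + a kstar * (ξ - ((kstar : ℝ) - 1) / 2 ^ n)) := by
    rw [S2_eq_average hi1 hi2 (hcont.intervalIntegrable 0 1) hx1 hx2]
    have hcongr : Set.EqOn (fun s => ∫ t in ξ..s, f t)
        (fun s => a i * s + (∑ j ∈ Finset.Ico 1 i, a j / 2 ^ n - a i * (((i : ℝ) - 1) / 2 ^ n) -
          (∑ j ∈ Finset.Ico 1 kstar, a j / 2 ^ n + a kstar * (ξ - ((kstar : ℝ) - 1) / 2 ^ n))))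
        (Set.uIcc (((i : ℝ) - 1) / 2 ^ n) ((i : ℝ) / 2 ^ n)) := by
      intro s hs
      rw [Set.uIcc_of_le (hx1.trans hx2.le)] at hs
      simp only [hF s, integral_step hfi hfa hi1 hi2 hs.1 hs.2,
        integral_step hfi hfa hk1 hk2 hξ1 hξ2.le]
      ring
    rw [intervalIntegral.integral_congr hcongr, intervalIntegral.integral_add
      (Continuous.intervalIntegrable (by fun_prop) _ _) (by simp),
      intervalIntegral.integral_const_mul, integral_id, intervalIntegral.integral_const,
      smul_eq_mul, pow_succ]
    field_simp
    ring
  rw [hS]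
  refine ⟨fun h => ?_, fun h => ?_, fun h => ?_⟩
  · rw [sum_Ico_one_eq_add hk1 h]
    ring
  · subst h
    rw [pow_succ]
    field_simp
    ring
  · rw [sum_Ico_one_eq_add hi1 h, pow_succ]
    field_simp
    ring
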